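/- arXiv:1709.00121 — 8 statements merged into one kernel-verified Lean document; each statement's English description precedes it below -/
import Mathlib

section
/- In the free (noncommutative, associative, unital) algebra k⟨x,y⟩ over a field k of characteristic zero, the two-sided ideal generated by the set {x^{m+1}y − y x^{m+1} − (m+1) y x^m y : m ∈ ℕ} is equal to the two-sided ideal generated by the single element xy − yx − y². -/
/-- If a two-sided ideal contains `x * y - y * x - y ^ 2`, then modulo it
`x ^ (m + 1) * y = y * x ^ (m + 1) + (m + 1) * y * x ^ m * y`. -/
theorem TwoSidedIdeal.pow_succ_mul_sub_mem {R : Type*} [Ring R] (I : TwoSidedIdeal R) {x y : R}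
    (h : x * y - y * x - y ^ 2 ∈ I) (m : ℕ) :
    x ^ (m + 1) * y - y * x ^ (m + 1) - ((m + 1 : ℕ) : R) * (y * x ^ m * y) ∈ I := by
  induction m with
  | zero => simpa [sq] using h
  | succ m ih =>
    have key : x ^ (m + 1 + 1) * y - y * x ^ (m + 1 + 1)
        - ((m + 1 + 1 : ℕ) : R) * (y * x ^ (m + 1) * y) =
        x * (x ^ (m + 1) * y - y * x ^ (m + 1) - ((m + 1 : ℕ) : R) * (y * x ^ m * y))
        - y * (x ^ (m + 1) * y - y * x ^ (m + 1) - ((m + 1 : ℕ) : R) * (y * x ^ m * y))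
        + (x * y - y * x - y ^ 2) * (x ^ (m + 1) + (m + 1) • (x ^ m * y)) := by
      rw [Nat.cast_succ (m + 1)]
      simp only [← nsmul_eq_mul, add_mul, one_mul, mul_add, mul_sub, sub_mul, mul_smul_comm, smul_sub,
        pow_succ' x, sq, mul_assoc]
      abel
    rw [key]
    exact I.add_mem (I.sub_mem (I.mul_mem_left _ _ ih) (I.mul_mem_left _ _ ih))
      (I.mul_mem_right _ _ h)


theorem stmt_0 (k : Type*) [Field k] [CharZero k] :
    TwoSidedIdeal.span
      {z : FreeAlgebra k (Fin 2) | ∃ m : ℕ,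
        z = FreeAlgebra.ι k (0 : Fin 2) ^ (m + 1) * FreeAlgebra.ι k (1 : Fin 2)
            - FreeAlgebra.ι k (1 : Fin 2) * FreeAlgebra.ι k (0 : Fin 2) ^ (m + 1)
            - ((m + 1 : ℕ) : FreeAlgebra k (Fin 2)) *
                (FreeAlgebra.ι k (1 : Fin 2) * FreeAlgebra.ι k (0 : Fin 2) ^ m
                  * FreeAlgebra.ι k (1 : Fin 2))} =
    TwoSidedIdeal.span
      {FreeAlgebra.ι k (0 : Fin 2) * FreeAlgebra.ι k (1 : Fin 2)
        - FreeAlgebra.ι k (1 : Fin 2) * FreeAlgebra.ι k (0 : Fin 2)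
        - FreeAlgebra.ι k (1 : Fin 2) ^ 2} := by
  apply le_antisymm <;> rw [TwoSidedIdeal.span_le]
  · rintro _ ⟨m, rfl⟩
    refine TwoSidedIdeal.pow_succ_mul_sub_mem _ ?_ m
    exact TwoSidedIdeal.subset_span (Set.mem_singleton _)
  · rintro _ rfl
    refine TwoSidedIdeal.subset_span ?_
    exact ⟨0, by simp [sq]⟩
end

section
/- Let k be a field of characteristic zero, let M be a module over the polynomial ring k[x], and let p : M → M be a k-linear map. Then the following are equivalent: (i) for every m ∈ ℕ and every v ∈ M, (1/(m+1))·(x^{m+1}·p(v)) = p((1/(m+1))·(x^{m+1}·v) + x^m·p(v)); (ii) for every v ∈ M, x·p(v) − p(x·v) = p(p(v)). -/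
/-- If `x p - p x = p²`, then `xⁿ⁺¹ p = p xⁿ⁺¹ + (n + 1) p xⁿ p`. -/
lemma pow_succ_smul_map_of_smul_map_sub {R M : Type*} [Monoid R] [AddCommGroup M]
    [DistribMulAction R M] (x : R) (p : M →+ M)
    (h : ∀ v, x • p v - p (x • v) = p (p v)) (n : ℕ) (v : M) :
    x ^ (n + 1) • p v = p (x ^ (n + 1) • v) + (n + 1) • p (x ^ n • p v) := by
  have hx (w : M) : x • p w = p (x • w) + p (p w) := by
    rw [← h w, add_sub_cancel]
  induction n with
  | zero => simp [hx]
  | succ n ih =>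
    rw [pow_succ' x (n + 1), mul_smul, ih, smul_add, smul_comm x (n + 1), hx, hx, smul_smul,
      smul_smul, ← pow_succ' x n, mul_smul, ih]
    simp only [map_add, map_nsmul, nsmul_add, succ_nsmul _ (n + 1)]
    abel


theorem stmt_2 (k : Type*) [Field k] [CharZero k] (M : Type*) [AddCommGroup M]
    [Module k M] [Module (Polynomial k) M] [IsScalarTower k (Polynomial k) M]
    (p : M →ₗ[k] M) :
    (∀ (m : ℕ) (v : M),
        ((m + 1 : k))⁻¹ • ((Polynomial.X ^ (m + 1) : Polynomial k) • p v) =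
          p (((m + 1 : k))⁻¹ • ((Polynomial.X ^ (m + 1) : Polynomial k) • v)
              + (Polynomial.X ^ m : Polynomial k) • p v)) ↔
    (∀ v : M, (Polynomial.X : Polynomial k) • p v - p ((Polynomial.X : Polynomial k) • v)
        = p (p v)) := by
  constructor
  · intro h v
    have h₀ := h 0 v
    simp only [Nat.cast_zero, zero_add, inv_one, one_smul, pow_one, pow_zero, map_add] at h₀
    rw [h₀, add_sub_cancel_left]
  · intro h m v
    have hm : (m + 1 : k) ≠ 0 := Nat.cast_add_one_ne_zero m
    have key := pow_succ_smul_map_of_smul_map_sub (Polynomial.X : Polynomial k)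
      p.toAddMonoidHom h m v
    simp only [LinearMap.toAddMonoidHom_coe] at key
    rw [key, p.map_add, p.map_smul, smul_add, ← Nat.cast_smul_eq_nsmul k, Nat.cast_add_one,
      inv_smul_smul₀ hm]
end

section
/- Let k be a field of characteristic zero, M a nonzero finite-dimensional k[x]-module with x acting as the k-linear map τ, and p : M → M a k-linear map satisfying τ∘p − p∘τ = p∘p. Then the only k-subspaces of M that are invariant under both τ and p are 0 and M if and only if M is a simple k[x]-module and p = 0. -/
/-- In characteristic zero, on a nonzero finite-dimensional space, a solution `p` of
`τ p - p τ = p ^ 2` is never invertible: otherwise `τ p⁻¹ - p τ p⁻² = 1` would have trace zero. -/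
theorem not_isUnit_of_commutator_eq_sq {k M : Type*} [Field k] [CharZero k] [AddCommGroup M]
    [Module k M] [FiniteDimensional k M] [Nontrivial M] {τ p : Module.End k M}
    (h : τ * p - p * τ = p * p) : ¬ IsUnit p := by
  rintro ⟨u, rfl⟩
  set q : Module.End k M := ↑u⁻¹
  have huq : (u : Module.End k M) * q = 1 := u.mul_inv
  have hqu : q * (u : Module.End k M) = 1 := u.inv_mul
  have hone : τ * q - u * (τ * q * q) = 1 :=
    calc τ * q - u * (τ * q * q) = τ * (u * q) * q - u * (τ * q * q) := by rw [huq, mul_one]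
      _ = (τ * u - u * τ) * q * q := by noncomm_ring
      _ = u * (u * q) * q := by rw [h]; noncomm_ring
      _ = 1 := by rw [huq, mul_one, huq]
  have htr := congrArg (LinearMap.trace k M) hone
  rw [map_sub, LinearMap.trace_mul_comm k (u : Module.End k M), mul_assoc, hqu, mul_one, sub_self,
    LinearMap.trace_one] at htr
  exact Module.finrank_pos.ne' (Nat.cast_eq_zero.1 htr.symm)

theorem stmt_5 (k : Type*) [Field k] [CharZero k] (M : Type*) [AddCommGroup M]
    [Module k M] [FiniteDimensional k M] [Nontrivial M] (τ p : M →ₗ[k] M)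
    (h : τ ∘ₗ p - p ∘ₗ τ = p ∘ₗ p) :
    (∀ W : Submodule k M, (∀ v ∈ W, τ v ∈ W) → (∀ v ∈ W, p v ∈ W) → W = ⊥ ∨ W = ⊤) ↔
      ((∀ W : Submodule k M, (∀ v ∈ W, τ v ∈ W) → W = ⊥ ∨ W = ⊤) ∧ p = 0) := by
  refine ⟨fun H => ?_, fun H W hτ _ => H.1 W hτ⟩
  have hp : p = 0 := by
    have hker : ∀ v ∈ LinearMap.ker p, τ v ∈ LinearMap.ker p := by
      intro v hv
      rw [LinearMap.mem_ker] at hv ⊢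
      simpa [hv] using LinearMap.congr_fun h v
    rcases H (LinearMap.ker p) hker (fun v hv => by simp [LinearMap.mem_ker.1 hv]) with hbot | htop
    · exact absurd ((LinearMap.isUnit_iff_ker_eq_bot p).2 hbot) (not_isUnit_of_commutator_eq_sq h)
    · exact LinearMap.ker_eq_top.1 htop
  exact ⟨fun W hW => H W hW fun v _ => by simp [hp], hp⟩
end

section
/- Let k be a field of characteristic zero, M a k[x]-module with x acting as the k-linear map τ, p : M → M a k-linear map, and h ∈ k[x] a polynomial. If (ad τ)^ℓ(p) = 0 for some integer ℓ ≥ 1, where (ad τ)(q) = τ∘q − q∘τ, then the subspace M_h = {v ∈ M : h(τ)^t v = 0 for some integer t > 0} is invariant under p. -/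
/-- If a submodule `N` is invariant under `τ` and under the commutator of `τ` with `p`, then it is
invariant under the commutator of `p` with every polynomial in `τ`. -/
lemma commutator_aeval_mem {R M : Type*} [CommRing R] [AddCommGroup M] [Module R M]
    {τ p : Module.End R M} {N : Submodule R M} (hτ : ∀ v ∈ N, τ v ∈ N)
    (hp : ∀ v ∈ N, (τ * p - p * τ) v ∈ N) (f : Polynomial R) :
    ∀ v ∈ N, (Polynomial.aeval τ f * p - p * Polynomial.aeval τ f) v ∈ N := by
  induction f using Polynomial.induction_on' with
  | add f g hf hg =>
    intro v hv
    convert N.add_mem (hf v hv) (hg v hv) using 1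
    simp only [map_add, LinearMap.sub_apply, Module.End.mul_apply, LinearMap.add_apply]
    abel
  | monomial n a =>
    have hpow : ∀ n : ℕ, ∀ v ∈ N, (τ ^ n * p - p * τ ^ n) v ∈ N := by
      intro n
      induction n with
      | zero => simp
      | succ n ih =>
        intro v hv
        have hτn : (τ ^ n) v ∈ N := by
          rw [Module.End.coe_pow]
          exact Set.MapsTo.iterate (s := (N : Set M)) (fun w hw => hτ w hw) n hv
        convert N.add_mem (hτ _ (ih v hv)) (hp _ hτn) using 1
        simp [pow_succ', Module.End.mul_apply]
    intro v hv
    convert N.smul_mem a (hpow n v hv) using 1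
    simp [Polynomial.aeval_monomial, Module.algebraMap_end_apply, smul_sub]

/-- An endomorphism annihilated by a power of `ad τ` preserves the generalized kernel of every
polynomial in `τ`. -/
lemma mapsTo_maxGenEigenspace_aeval_of_iterate_commutator_eq_zero {R M : Type*} [CommRing R]
    [AddCommGroup M] [Module R M] {τ : Module.End R M} (h : Polynomial R) (ℓ : ℕ) :
    ∀ p : Module.End R M, (fun q : Module.End R M => τ * q - q * τ)^[ℓ] p = 0 →
      ∀ v ∈ (Polynomial.aeval τ h).maxGenEigenspace 0,
        p v ∈ (Polynomial.aeval τ h).maxGenEigenspace 0 := by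
  induction ℓ with
  | zero =>
    intro p hp v _
    have hp0 : p = 0 := hp
    simp [hp0]
  | succ ℓ ih =>
    intro p hp v hv
    have hτ : ∀ w ∈ (Polynomial.aeval τ h).maxGenEigenspace 0,
        τ w ∈ (Polynomial.aeval τ h).maxGenEigenspace 0 :=
      Module.End.mapsTo_maxGenEigenspace_of_comm
        (by simpa using (Commute.all h Polynomial.X).map (Polynomial.aeval τ)) 0
    obtain ⟨n, hn⟩ := (Module.End.mem_maxGenEigenspace _ _ _).1 hv
    rw [zero_smul, sub_zero] at hn
    have hc := commutator_aeval_mem hτ (ih _ hp) (h ^ n) v hv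
    rw [LinearMap.sub_apply, Module.End.mul_apply, Module.End.mul_apply, map_pow, hn, map_zero,
      sub_zero] at hc
    obtain ⟨m, hm⟩ := (Module.End.mem_maxGenEigenspace _ _ _).1 hc
    rw [zero_smul, sub_zero, ← Module.End.mul_apply, ← pow_add] at hm
    exact (Module.End.mem_maxGenEigenspace _ _ _).2 ⟨m + n, by simpa using hm⟩

theorem stmt_6 (k : Type*) [Field k] [CharZero k] (M : Type*) [AddCommGroup M]
    [Module k M] (τ p : Module.End k M) (h : Polynomial k) (ℓ : ℕ) (hℓ : 1 ≤ ℓ)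
    (had : (fun q : Module.End k M => τ * q - q * τ)^[ℓ] p = 0) :
    ∀ v : M, (∃ t : ℕ, 0 < t ∧ (Polynomial.aeval τ h ^ t) v = 0) →
      ∃ t : ℕ, 0 < t ∧ (Polynomial.aeval τ h ^ t) (p v) = 0 := by
  rintro v ⟨t, -, ht⟩
  have hv : v ∈ (Polynomial.aeval τ h).maxGenEigenspace 0 :=
    (Module.End.mem_maxGenEigenspace _ _ _).2 ⟨t, by simpa using ht⟩
  obtain ⟨m, hm⟩ := (Module.End.mem_maxGenEigenspace _ _ _).1
    (mapsTo_maxGenEigenspace_aeval_of_iterate_commutator_eq_zero h ℓ p had v hv)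
  rw [zero_smul, sub_zero] at hm
  exact ⟨m + 1, m.succ_pos, by rw [pow_succ', Module.End.mul_apply, hm, map_zero]⟩
end

section
/- Let k be a field of characteristic zero, M a finite-dimensional k[x]-module with x acting as the k-linear map τ, and p : M → M a k-linear map satisfying τ∘p − p∘τ = p∘p. Then for every polynomial h ∈ k[x], the subspace M_h = {v ∈ M : h(τ)^t v = 0 for some integer t > 0} is invariant under p. -/
/-- If `τ * p - p * τ = p * p`, the commutator of `τ` with a power of `p` is a multiple of the
next power. -/
theorem commutator_pow_of_commutator_eq_mul_self {R : Type*} [Ring R] {τ p : R}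
    (hcomm : τ * p - p * τ = p * p) (n : ℕ) :
    τ * p ^ n - p ^ n * τ = n • p ^ (n + 1) := by
  induction n with
  | zero => simp
  | succ n ih =>
    have e : τ * p ^ (n + 1) - p ^ (n + 1) * τ =
        (τ * p ^ n - p ^ n * τ) * p + p ^ n * (τ * p - p * τ) := by
      rw [pow_succ]; noncomm_ring
    rw [e, ih, hcomm, succ_nsmul, smul_mul_assoc, ← pow_succ, ← mul_assoc, ← pow_succ, ← pow_succ]

/-- If `τ * p - p * τ = p * p`, the commutator of `τ` with `f(p)` is `f'(p) * p ^ 2`. -/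
theorem commutator_aeval_of_commutator_eq_mul_self {k R : Type*} [Field k] [Ring R] [Algebra k R]
    {τ p : R} (hcomm : τ * p - p * τ = p * p) (f : Polynomial k) :
    τ * Polynomial.aeval p f - Polynomial.aeval p f * τ =
      Polynomial.aeval p (Polynomial.derivative f * Polynomial.X ^ 2) := by
  induction f using Polynomial.induction_on' with
  | add f g hf hg =>
    simp only [map_add, mul_add, add_mul] at hf hg ⊢
    rw [← hf, ← hg]; abel
  | monomial n a =>
    rw [← Polynomial.C_mul_X_pow_eq_monomial, Polynomial.derivative_C_mul_X_pow]
    simp only [map_mul, Polynomial.aeval_C, map_pow, Polynomial.aeval_X, map_natCast]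
    rw [← mul_assoc, ← Algebra.commutes a τ, mul_assoc, mul_assoc, ← mul_sub,
      commutator_pow_of_commutator_eq_mul_self hcomm n, mul_assoc, mul_assoc, ← pow_add]
    rcases n with _ | n
    · simp
    · simp [nsmul_eq_mul]

/-- In characteristic zero, a nonzero polynomial dividing `f' * X ^ 2` divides a power of `X`. -/
theorem Polynomial.dvd_X_pow_of_dvd_derivative_mul_X_sq {k : Type*} [Field k] [CharZero k]
    {f : Polynomial k} (hf : f ≠ 0) (hd : f ∣ derivative f * X ^ 2) : ∃ n : ℕ, f ∣ X ^ n := by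
  obtain ⟨g, hg, hng⟩ := exists_eq_pow_rootMultiplicity_mul_and_not_dvd f hf 0
  rw [C_0, sub_zero] at hg hng
  set a := rootMultiplicity 0 f
  have hcop : IsCoprime g (X ^ (a + 2)) :=
    ((irreducible_X.coprime_iff_not_dvd.2 hng).symm).pow_right
  have h1 : g ∣ derivative f * X ^ 2 := (Dvd.intro_left _ hg.symm).trans hd
  have h2 : g ∣ derivative g * X ^ (a + 2) := by
    have e : derivative f * X ^ 2 =
        derivative g * X ^ (a + 2) + g * (derivative (X ^ a) * X ^ 2) := by
      rw [hg, derivative_mul]; ring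
    rw [e] at h1
    exact (dvd_add_left (dvd_mul_right _ _)).1 h1
  have h3 : g ∣ derivative g := hcop.dvd_of_dvd_mul_right h2
  have hg0 : g ≠ 0 := fun h => hng (h ▸ dvd_zero _)
  have h4 : derivative g = 0 := by
    by_contra hne
    exact (degree_derivative_lt hg0).not_ge (degree_le_of_dvd h3 hne)
  have hu : IsUnit g := isUnit_iff_degree_eq_zero.2 (by
    rw [degree_eq_natDegree hg0, derivative_eq_zero.1 h4]; rfl)
  refine ⟨a, ?_⟩
  rw [hg]
  exact (hu.mul_right_dvd).2 dvd_rfl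

/-- If `τ * p - p * τ = p * p` and `p` is integral over a field of characteristic zero, then `p`
is nilpotent. -/
theorem isNilpotent_of_commutator_eq_mul_self {k R : Type*} [Field k] [CharZero k] [Ring R]
    [Algebra k R] {τ p : R} (hp : IsIntegral k p) (hcomm : τ * p - p * τ = p * p) :
    IsNilpotent p := by
  have h := commutator_aeval_of_commutator_eq_mul_self hcomm (minpoly k p)
  rw [minpoly.aeval, mul_zero, zero_mul, sub_zero] at h
  obtain ⟨n, hn⟩ := Polynomial.dvd_X_pow_of_dvd_derivative_mul_X_sq (minpoly.ne_zero hp)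
    (minpoly.dvd k p h.symm)
  refine ⟨n, ?_⟩
  simpa using Polynomial.aeval_eq_zero_of_dvd_aeval_eq_zero hn (minpoly.aeval k p)

/-- A submodule stable under `τ` is stable under `f(τ)`. -/
theorem aeval_apply_mem_of_stable {k M : Type*} [Field k] [AddCommGroup M] [Module k M]
    {τ : Module.End k M} {W : Submodule k M} (hτ : ∀ v ∈ W, τ v ∈ W) (f : Polynomial k) :
    ∀ v ∈ W, Polynomial.aeval τ f v ∈ W := by
  induction f using Polynomial.induction_on with
  | C a => intro v hv; simpa [Module.algebraMap_end_apply] using W.smul_mem a hv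
  | add f g hf hg => intro v hv; simpa using W.add_mem (hf v hv) (hg v hv)
  | monomial n a ih =>
    intro v hv
    rw [pow_succ, ← mul_assoc, map_mul (Polynomial.aeval τ) _ Polynomial.X, Polynomial.aeval_X]
    exact ih (τ v) (hτ v hv)

/-- If `W` is stable under `τ` and the commutator of `τ` with `q` maps `W` to itself, then so does
the commutator of `f(τ)` with `q`. -/
theorem commutator_aeval_apply_mem {k M : Type*} [Field k] [AddCommGroup M] [Module k M]
    {τ q : Module.End k M} {W : Submodule k M} (hτ : ∀ v ∈ W, τ v ∈ W)
    (hq : ∀ v ∈ W, τ (q v) - q (τ v) ∈ W) (f : Polynomial k) :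
    ∀ v ∈ W, Polynomial.aeval τ f (q v) - q (Polynomial.aeval τ f v) ∈ W := by
  induction f using Polynomial.induction_on with
  | C a => intro v _; simp [Module.algebraMap_end_apply]
  | add f g hf hg =>
    intro v hv
    have := W.add_mem (hf v hv) (hg v hv)
    simp only [map_add, LinearMap.add_apply]
    convert this using 1
    abel
  | monomial n a ih =>
    intro v hv
    have := W.add_mem (ih (τ v) (hτ v hv)) (aeval_apply_mem_of_stable hτ
      (Polynomial.C a * Polynomial.X ^ n) _ (hq v hv))
    rw [pow_succ, ← mul_assoc, map_mul (Polynomial.aeval τ) _ Polynomial.X, Polynomial.aeval_X]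
    simp only [Module.End.mul_apply]
    rw [map_sub] at this
    convert this using 1
    abel

theorem stmt_7 (k : Type*) [Field k] [CharZero k] (M : Type*) [AddCommGroup M]
    [Module k M] [FiniteDimensional k M] (τ p : Module.End k M)
    (hcomm : τ * p - p * τ = p * p) :
    ∀ h : Polynomial k, ∀ v : M, (∃ t : ℕ, 0 < t ∧ (Polynomial.aeval τ h ^ t) v = 0) →
      ∃ t : ℕ, 0 < t ∧ (Polynomial.aeval τ h ^ t) (p v) = 0 := by
  intro h v hv
  set H := Polynomial.aeval τ h
  set W := H.maxGenEigenspace 0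
  have hW : ∀ w, w ∈ W ↔ ∃ t : ℕ, (H ^ t) w = 0 := fun w => by
    simp [W, Module.End.mem_maxGenEigenspace]
  have hτ : ∀ w ∈ W, τ w ∈ W := fun w hw =>
    Module.End.mapsTo_maxGenEigenspace_of_comm
      (by simpa using (Commute.all h Polynomial.X).map (Polynomial.aeval τ))
      0 hw
  obtain ⟨N, hN⟩ := isNilpotent_of_commutator_eq_mul_self (Algebra.IsIntegral.isIntegral (R := k) p)
    hcomm
  have step (m : ℕ) (hm : ∀ w ∈ W, (p ^ (m + 1)) w ∈ W) : ∀ w ∈ W, (p ^ m) w ∈ W := by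
    have hc := commutator_aeval_apply_mem (q := p ^ m) hτ (fun w hw => by
      have e := LinearMap.congr_fun (commutator_pow_of_commutator_eq_mul_self hcomm m) w
      simp only [LinearMap.sub_apply, Module.End.mul_apply, LinearMap.smul_apply] at e
      rw [e]
      exact W.smul_of_tower_mem m (hm w hw)) h
    have key (t : ℕ) : ∀ w, (H ^ t) w = 0 → (p ^ m) w ∈ W := by
      induction t with
      | zero => intro w hw; simp_all
      | succ t ih =>
        intro w hw
        have h1 := ih (H w) (by rwa [← Module.End.mul_apply, ← pow_succ])
        have h2 := W.add_mem (hc w ((hW w).2 ⟨_, hw⟩)) h1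
        rw [sub_add_cancel] at h2
        obtain ⟨s, hs⟩ := (hW _).1 h2
        exact (hW _).2 ⟨s + 1, by rwa [pow_succ, Module.End.mul_apply]⟩
    intro w hw
    obtain ⟨t, ht⟩ := (hW w).1 hw
    exact key t w ht
  have hp : ∀ w ∈ W, (p ^ 1) w ∈ W := by
    refine Nat.decreasingInduction' (P := fun m => ∀ w ∈ W, (p ^ m) w ∈ W)
      (fun m _ _ => step m) (Nat.le_add_left 1 N) fun w _ => ?_
    simp [pow_succ, hN]
  obtain ⟨t, -, ht⟩ := hv
  obtain ⟨s, hs⟩ := (hW _).1 (hp v ((hW v).2 ⟨t, ht⟩))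
  exact ⟨s + 1, s.succ_pos, by rw [pow_succ', Module.End.mul_apply, ← pow_one p, hs, map_zero]⟩
end

section
/- Let k be a field of characteristic zero, M a nonzero finite-dimensional k[x]-module with x acting as the k-linear map τ, and p : M → M a k-linear map satisfying τ∘p − p∘τ = p∘p. Write the minimal polynomial of τ as f = h₁^{r₁}⋯h_s^{r_s}, where h₁,…,h_s are distinct monic irreducible polynomials in k[x] and r₁,…,r_s ≥ 1, and set M_i = {v ∈ M : h_i(τ)^t v = 0 for some t > 0} for 1 ≤ i ≤ s. Then each M_i is invariant under both τ and p, and M is the internal direct sum M = M₁ ⊕ ⋯ ⊕ M_s; consequently (M,p) is the direct sum of the Rota–Baxter submodules (M_i, p|_{M_i}). -/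
open Polynomial in
/-- If `[τ, p] = p²`, then `[τ, ·]` acts on polynomials in `p` as the derivation `X² d/dX`. -/
theorem commutator_aeval_eq {k A : Type*} [CommRing k] [Ring A] [Algebra k A] {τ p : A}
    (hcomm : τ * p - p * τ = p * p) (q : k[X]) :
    τ * aeval p q - aeval p q * τ = aeval p (derivative q * X ^ 2) := by
  induction q using Polynomial.induction_on with
  | C a => simp [Algebra.commutes]
  | add f g hf hg =>
    simp only [map_add, add_mul, mul_add, ← hf, ← hg]
    abel
  | monomial n a ih =>
    have key : C a * X ^ (n + 1) = (C a * X ^ n) * X := by ring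
    rw [key]
    generalize C a * X ^ n = q at ih ⊢
    have expand : derivative (q * X) * X ^ 2 = (derivative q * X ^ 2) * X + q * X ^ 2 := by
      simp only [derivative_mul, derivative_X]
      ring
    rw [expand, map_add, map_mul (aeval p) q X, map_mul (aeval p) (derivative q * X ^ 2) X, ← ih]
    simp only [map_mul, aeval_X, pow_two, ← hcomm]
    noncomm_ring

open Polynomial in
theorem isNilpotent_of_commutator_eq_sq {k A : Type*} [Field k] [CharZero k] [Ring A]
    [Algebra k A] [FiniteDimensional k A] {τ p : A} (hcomm : τ * p - p * τ = p * p) :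
    IsNilpotent p := by
  have hne : minpoly k p ≠ 0 := minpoly.ne_zero (Algebra.IsIntegral.isIntegral p)
  obtain ⟨g, hg, hXg⟩ := exists_eq_pow_rootMultiplicity_mul_and_not_dvd (minpoly k p) hne 0
  rw [C_0, sub_zero] at hg hXg
  generalize rootMultiplicity 0 (minpoly k p) = m at hg
  have hdvd : minpoly k p ∣ derivative (minpoly k p) * X ^ 2 := by
    apply minpoly.dvd
    rw [← commutator_aeval_eq hcomm, minpoly.aeval]
    simp
  have hcop : IsCoprime g (X ^ (m + 2)) :=
    ((prime_X.coprime_iff_not_dvd.mpr hXg).symm).pow_right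
  have hg' : g ∣ derivative g := by
    have h1 : g ∣ derivative (minpoly k p) * X ^ 2 :=
      (Dvd.intro_left (X ^ m) hg.symm).trans hdvd
    have h2 : derivative (minpoly k p) * X ^ 2 =
        g * (derivative (X ^ m) * X ^ 2) + X ^ (m + 2) * derivative g := by
      rw [hg, derivative_mul]
      ring
    rw [h2, dvd_add_right (dvd_mul_right _ _)] at h1
    exact hcop.dvd_of_dvd_mul_left h1
  have hg0 : g ≠ 0 := by
    rintro rfl
    exact hXg (dvd_zero _)
  have hder : derivative g = 0 := by
    by_contra hd
    exact absurd (degree_le_of_dvd hg' hd) (not_le.mpr (degree_derivative_lt hg0))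
  have hC := eq_C_of_natDegree_eq_zero (derivative_eq_zero.mp hder)
  have hc : g.coeff 0 ≠ 0 := by
    intro hc
    rw [hc, C_0] at hC
    exact hg0 hC
  refine ⟨m, ?_⟩
  have h0 := minpoly.aeval k p
  rw [hg, hC, map_mul, map_pow, aeval_X, aeval_C, ← Algebra.commutes, ← Algebra.smul_def] at h0
  exact (smul_eq_zero.mp h0).resolve_left hc

theorem Module.End.mem_iSup_ker_pow {k M : Type*} [CommRing k] [AddCommGroup M] [Module k M]
    (φ : Module.End k M) (v : M) :
    v ∈ (⨆ t : ℕ, LinearMap.ker (φ ^ t)) ↔ ∃ t : ℕ, (φ ^ t) v = 0 := by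
  exact Submodule.mem_iSup_of_directed _ φ.iterateKer.monotone.directed_le

open Polynomial in
theorem map_mem_iSup_ker_pow_aeval {k M : Type*} [Field k] [AddCommGroup M]
    [Module k M] {τ p : Module.End k M} (hcomm : τ * p - p * τ = p * p) (hp : IsNilpotent p)
    (q : k[X]) {v : M} (hv : v ∈ (⨆ t : ℕ, LinearMap.ker (aeval τ q ^ t))) :
    p v ∈ (⨆ t : ℕ, LinearMap.ker (aeval τ q ^ t)) := by
  have hmem := Module.End.mem_iSup_ker_pow (aeval τ q)
  set N := ⨆ t : ℕ, LinearMap.ker (aeval τ q ^ t) with hN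
  have haeval (g : k[X]) {w : M} (hw : w ∈ N) : aeval τ g w ∈ N := by
    obtain ⟨t, ht⟩ := (hmem w).mp hw
    refine (hmem _).mpr ⟨t, ?_⟩
    rw [← map_pow] at ht ⊢
    rw [← Module.End.mul_apply, ← map_mul, mul_comm, map_mul, Module.End.mul_apply, ht, map_zero]
  have hsat {t : ℕ} {w : M} (hw : (aeval τ q ^ t) w ∈ N) : w ∈ N := by
    obtain ⟨u, hu⟩ := (hmem _).mp hw
    refine (hmem _).mpr ⟨u + t, ?_⟩
    rw [pow_add, Module.End.mul_apply, hu]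
  have hpow (n : ℕ) (w : M) : τ ((p ^ n) w) = (p ^ n) (τ w) + (n : k) • (p ^ (n + 1)) w := by
    have := commutator_aeval_eq (k := k) hcomm (X ^ n)
    have h2 : derivative (X ^ n : k[X]) * X ^ 2 = C (n : k) * X ^ (n + 1) := by
      cases n with
      | zero => simp
      | succ n => rw [derivative_X_pow]; simp only [Nat.add_sub_cancel]; ring
    rw [h2, map_mul, map_pow, map_pow, aeval_X, aeval_C, sub_eq_iff_eq_add',
      ← Algebra.smul_def] at this
    exact LinearMap.congr_fun this w
  have hstep (n : ℕ) (hn : ∀ w ∈ N, (p ^ (n + 1)) w ∈ N) : ∀ w ∈ N, (p ^ n) w ∈ N := by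
    have hcongr (g : k[X]) : ∀ w ∈ N, aeval τ g ((p ^ n) w) - (p ^ n) (aeval τ g w) ∈ N := by
      induction g using Polynomial.induction_on with
      | C a => simp
      | add f g hf hg =>
        intro w hw
        simp only [map_add, LinearMap.add_apply, add_sub_add_comm]
        exact N.add_mem (hf w hw) (hg w hw)
      | monomial m a ih =>
        have key : C a * X ^ (m + 1) = (C a * X ^ m) * X := by ring
        rw [key]
        generalize C a * X ^ m = g at ih ⊢
        intro w hw
        have hτw : τ w ∈ N := by simpa using haeval X hw
        have := N.add_mem (ih (τ w) hτw) (haeval g (N.smul_mem (n : k) (hn w hw)))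
        simp only [map_mul, aeval_X, Module.End.mul_apply, hpow, map_add]
        convert this using 1
        abel
    intro w hw
    obtain ⟨t, ht⟩ := (hmem w).mp hw
    have := hcongr (q ^ t) w hw
    rw [map_pow, ht, map_zero, sub_zero] at this
    exact hsat this
  obtain ⟨m, hm⟩ := hp
  have hall : ∀ w ∈ N, (p ^ 1) w ∈ N := by
    refine Nat.decreasingInduction' (m := 1) (n := m + 1) (P := fun n => ∀ w ∈ N, (p ^ n) w ∈ N)
      (fun n _ _ hn => hstep n hn) (by omega) ?_
    intro w _
    simp [pow_succ, hm]
  simpa using hall v hv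

open Polynomial in
theorem iSup_ker_aeval_eq_ker_aeval_prod {k M ι : Type*} [Field k] [AddCommGroup M]
    [Module k M] (τ : Module.End k M) (q : ι → k[X]) (hq : Pairwise (Function.onFun IsCoprime q))
    (S : Finset ι) :
    ⨆ i ∈ S, LinearMap.ker (aeval τ (q i)) = LinearMap.ker (aeval τ (∏ i ∈ S, q i)) := by
  classical
  induction S using Finset.induction_on with
  | empty => simp [Module.End.one_eq_id]
  | insert a S ha ih =>
    rw [Finset.iSup_insert, ih, Finset.prod_insert ha]
    refine sup_ker_aeval_eq_ker_aeval_mul_of_coprime τ (IsCoprime.prod_right fun i hi => hq ?_)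
    rintro rfl
    exact ha hi

open Polynomial in
theorem isInternal_ker_aeval {k M ι : Type*} [Field k] [AddCommGroup M] [Module k M] [Fintype ι]
    [DecidableEq ι] (τ : Module.End k M) (q : ι → k[X]) (hq : Pairwise (Function.onFun IsCoprime q))
    (hτ : aeval τ (∏ i, q i) = 0) :
    DirectSum.IsInternal fun i => LinearMap.ker (aeval τ (q i)) := by
  rw [DirectSum.isInternal_submodule_iff_iSupIndep_and_iSup_eq_top]
  constructor
  · intro i
    have := iSup_ker_aeval_eq_ker_aeval_prod τ q hq (Finset.univ.erase i)
    simp only [Finset.mem_erase, Finset.mem_univ, and_true] at this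
    rw [this]
    exact disjoint_ker_aeval_of_isCoprime τ
      (IsCoprime.prod_right fun j hj => hq (Finset.ne_of_mem_erase hj).symm)
  · have := iSup_ker_aeval_eq_ker_aeval_prod τ q hq Finset.univ
    simpa [hτ] using this


theorem stmt_8 (k : Type*) [Field k] [CharZero k] (M : Type*) [AddCommGroup M]
    [Module k M] [FiniteDimensional k M] [Nontrivial M]
    (τ p : Module.End k M) (hcomm : τ * p - p * τ = p * p)
    (s : ℕ) (h : Fin s → Polynomial k) (r : Fin s → ℕ)
    (hmonic : ∀ i, (h i).Monic) (hirr : ∀ i, Irreducible (h i))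
    (hdist : Function.Injective h) (hr : ∀ i, 1 ≤ r i)
    (hfact : minpoly k τ = ∏ i, h i ^ r i) :
    (∀ i : Fin s, ∀ v : M,
        v ∈ (⨆ t : ℕ, LinearMap.ker (Polynomial.aeval τ (h i) ^ t)) ↔
          ∃ t : ℕ, 0 < t ∧ (Polynomial.aeval τ (h i) ^ t) v = 0) ∧
    (∀ i : Fin s, ∀ v ∈ (⨆ t : ℕ, LinearMap.ker (Polynomial.aeval τ (h i) ^ t)),
        τ v ∈ (⨆ t : ℕ, LinearMap.ker (Polynomial.aeval τ (h i) ^ t)) ∧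
        p v ∈ (⨆ t : ℕ, LinearMap.ker (Polynomial.aeval τ (h i) ^ t))) ∧
    DirectSum.IsInternal
      (fun i : Fin s => ⨆ t : ℕ, LinearMap.ker (Polynomial.aeval τ (h i) ^ t)) := by
  have hmem (i : Fin s) := Module.End.mem_iSup_ker_pow (Polynomial.aeval τ (h i))
  refine ⟨fun i v => ?_, fun i v hv => ⟨?_, ?_⟩, ?_⟩
  · rw [hmem]
    refine ⟨fun ⟨t, ht⟩ => ⟨t + 1, t.succ_pos, ?_⟩, fun ⟨t, _, ht⟩ => ⟨t, ht⟩⟩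
    rw [pow_succ', Module.End.mul_apply, ht, map_zero]
  · obtain ⟨t, ht⟩ := (hmem i v).mp hv
    refine (hmem i _).mpr ⟨t, ?_⟩
    have hc : Commute (Polynomial.aeval τ (h i) ^ t) τ := by
      simpa using ((Commute.all (h i) Polynomial.X).map (Polynomial.aeval τ)).pow_left t
    rw [← Module.End.mul_apply, hc.eq, Module.End.mul_apply, ht, map_zero]
  · exact map_mem_iSup_ker_pow_aeval hcomm (isNilpotent_of_commutator_eq_sq (k := k) hcomm) (h i) hv
  · have hex (i : Fin s) : ∃ n, r i ≤ n ∧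
        ⨆ t : ℕ, LinearMap.ker (Polynomial.aeval τ (h i) ^ t) =
          LinearMap.ker (Polynomial.aeval τ (h i ^ n)) := by
      obtain ⟨n, hn⟩ := Filter.eventually_atTop.mp
        (Polynomial.aeval τ (h i)).eventually_iSup_ker_pow_eq
      exact ⟨max (r i) n, le_max_left _ _, by rw [map_pow, hn _ (le_max_right _ _)]⟩
    choose n hrn hn using hex
    simp only [hn]
    refine isInternal_ker_aeval τ _ (fun i j hij => ?_) ?_
    · refine IsCoprime.pow ((hirr i).coprime_iff_not_dvd.mpr fun hd => hij (hdist ?_))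
      exact Polynomial.eq_of_monic_of_associated (hmonic i) (hmonic j)
        ((hirr i).associated_of_dvd (hirr j) hd)
    · have hd : minpoly k τ ∣ ∏ i, h i ^ n i :=
        hfact ▸ Finset.prod_dvd_prod_of_dvd _ _ fun i _ => pow_dvd_pow _ (hrn i)
      exact Polynomial.aeval_eq_zero_of_dvd_aeval_eq_zero hd (minpoly.aeval k τ)
end

section
/- Let k be a field of characteristic zero, n ≥ 1, and let M_n = k[x]/(x^n) be the quotient k[x]-module. If p : M_n → M_n is a k-linear map satisfying x·p(v) − p(x·v) = p(p(v)) for all v ∈ M_n, then p(x̄^{n−1}) = 0, where x̄^{n−1} denotes the residue class of x^{n−1} in M_n. -/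
/-- If `J * P - P * J = P ^ 2` and `J e = 0`, then `J` acts on the `P`-orbit of `e` as
a weighted shift. -/
theorem apply_pow_of_commutator_eq_sq {k V : Type*} [CommRing k] [AddCommGroup V] [Module k V]
    {J P : Module.End k V} (h : ∀ v, J (P v) - P (J v) = P (P v)) {e : V} (he : J e = 0)
    (m : ℕ) : J ((P ^ m) e) = m • (P ^ (m + 1)) e := by
  induction m with
  | zero => simpa using he
  | succ m ih =>
    have h' := h ((P ^ m) e)
    rw [ih, sub_eq_iff_eq_add] at h'
    simp only [pow_succ' P (m + 1), pow_succ' P m, Module.End.mul_apply, map_nsmul] at h' ⊢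
    rw [h', succ_nsmul']

theorem pow_apply_of_commutator_eq_sq {k V : Type*} [CommRing k] [AddCommGroup V] [Module k V]
    {J P : Module.End k V} (h : ∀ v, J (P v) - P (J v) = P (P v)) {e : V} (he : J e = 0)
    (m : ℕ) : (J ^ m) (P e) = m.factorial • (P ^ (m + 1)) e := by
  induction m with
  | zero => simp
  | succ m ih =>
    rw [pow_succ' J, Module.End.mul_apply, ih, map_nsmul, apply_pow_of_commutator_eq_sq h he,
      smul_smul, Nat.factorial_succ, mul_comm]

theorem apply_eq_zero_of_commutator_eq_sq {k V : Type*} [Field k] [CharZero k] [AddCommGroup V]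
    [Module k V] {J P : Module.End k V} (h : ∀ v, J (P v) - P (J v) = P (P v)) {n : ℕ}
    (hJ : J ^ n = 0) {e : V} (he : J e = 0) (hker : ∀ v, J v = 0 → ∃ c : k, v = c • e) :
    P e = 0 := by
  have hex : ∃ m, (P ^ m) e = 0 := by
    refine ⟨n + 1, ?_⟩
    have h0 := pow_apply_of_commutator_eq_sq h he n
    rw [hJ, LinearMap.zero_apply, ← Nat.cast_smul_eq_nsmul k, eq_comm, smul_eq_zero] at h0
    exact h0.resolve_left (Nat.cast_ne_zero.mpr n.factorial_ne_zero)
  classical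
  obtain ⟨m, hm, hmin⟩ : ∃ m, (P ^ m) e = 0 ∧ ∀ l < m, (P ^ l) e ≠ 0 :=
    ⟨Nat.find hex, Nat.find_spec hex, fun _ hl => Nat.find_min hex hl⟩
  match m, hm, hmin with
  | 0, hm, _ => simp_all
  | 1, hm, _ => simpa using hm
  | t + 2, hm, hmin =>
    obtain ⟨c, hc⟩ := hker ((P ^ (t + 1)) e) <| by
      rw [apply_pow_of_commutator_eq_sq h he, hm, smul_zero]
    have hne := hmin (t + 1) (by omega)
    have hz : (P ^ (t + 1)) ((P ^ (t + 1)) e) = 0 := by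
      rw [← Module.End.mul_apply, ← pow_add, show t + 1 + (t + 1) = t + (t + 2) by ring, pow_add,
        Module.End.mul_apply, hm, map_zero]
    rw [hc, map_smul, smul_eq_zero] at hz
    rcases hz with rfl | hz
    · exact absurd (by simpa using hc) hne
    · exact absurd hz hne

theorem Polynomial.exists_mk_eq_smul_of_X_smul_eq_zero {k : Type*} [Field k] {n : ℕ} (hn : 1 ≤ n)
    (v : Polynomial k ⧸ Ideal.span ({Polynomial.X ^ n} : Set (Polynomial k)))
    (hv : (Polynomial.X : Polynomial k) • v = 0) :
    ∃ c : k, v = c • Ideal.Quotient.mk (Ideal.span ({Polynomial.X ^ n} : Set (Polynomial k)))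
      (Polynomial.X ^ (n - 1)) := by
  obtain ⟨m, rfl⟩ : ∃ m, n = m + 1 := ⟨n - 1, by omega⟩
  obtain ⟨f, rfl⟩ := Ideal.Quotient.mk_surjective v
  have hf : Ideal.Quotient.mk (Ideal.span {(X : Polynomial k) ^ (m + 1)}) (X * f) = 0 := hv
  rw [Ideal.Quotient.eq_zero_iff_mem, Ideal.mem_span_singleton, pow_succ',
    mul_dvd_mul_iff_left X_ne_zero] at hf
  obtain ⟨g, rfl⟩ := hf
  refine ⟨g.coeff 0, ?_⟩
  change _ = Ideal.Quotient.mk _ (g.coeff 0 • X ^ m)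
  rw [Ideal.Quotient.mk_eq_mk_iff_sub_mem, Ideal.mem_span_singleton, smul_eq_C_mul,
    mul_comm (C _), ← mul_sub, pow_succ]
  exact mul_dvd_mul_left _ (X_dvd_sub_C)

theorem stmt_11 (k : Type*) [Field k] [CharZero k] (n : ℕ) (hn : 1 ≤ n)
    (p : (Polynomial k ⧸ Ideal.span ({Polynomial.X ^ n} : Set (Polynomial k))) →ₗ[k]
          (Polynomial k ⧸ Ideal.span ({Polynomial.X ^ n} : Set (Polynomial k))))
    (hp : ∀ v, (Polynomial.X : Polynomial k) • p v
          - p ((Polynomial.X : Polynomial k) • v) = p (p v)) :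
    p (Ideal.Quotient.mk (Ideal.span ({Polynomial.X ^ n} : Set (Polynomial k)))
        (Polynomial.X ^ (n - 1))) = 0 := by
  have hXn : Ideal.Quotient.mk (Ideal.span ({Polynomial.X ^ n} : Set (Polynomial k)))
      (Polynomial.X ^ n) = 0 :=
    Ideal.Quotient.eq_zero_iff_mem.mpr (Ideal.mem_span_singleton_self _)
  refine apply_eq_zero_of_commutator_eq_sq (n := n)
    (J := LinearMap.mulLeft k (Ideal.Quotient.mk _ Polynomial.X)) hp ?_ ?_
    (Polynomial.exists_mk_eq_smul_of_X_smul_eq_zero hn)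
  · rw [LinearMap.pow_mulLeft, ← map_pow, hXn, LinearMap.mulLeft_zero_eq_zero]
  · rw [LinearMap.mulLeft_apply, ← map_mul, ← pow_succ', Nat.sub_add_cancel hn, hXn]
end

section
/- Let k be a field of characteristic zero, n ≥ 1, and let J ∈ M_n(k) be the nilpotent Jordan block, i.e., J_{i,i+1} = 1 for 1 ≤ i ≤ n−1 and all other entries of J are 0 (1-based indices). If B ∈ M_n(k) satisfies JB − BJ = B², then B is strictly upper triangular: B_{i,j} = 0 whenever j ≤ i. -/
/-- If `[a, b] = b ^ 2`, then `[a, b ^ m] = m b ^ (m + 1)`. -/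
theorem mul_pow_sub_pow_mul_of_commutator_eq_sq {R : Type*} [Ring R] {a b : R}
    (h : a * b - b * a = b ^ 2) (m : ℕ) :
    a * b ^ m - b ^ m * a = m * b ^ (m + 1) := by
  induction m with
  | zero => simp
  | succ m ih =>
    have e : a * b ^ (m + 1) - b ^ (m + 1) * a
        = (a * b ^ m - b ^ m * a) * b + b ^ m * (a * b - b * a) := by
      rw [pow_succ]; noncomm_ring
    rw [e, ih, h, mul_assoc, ← pow_succ, ← pow_add]
    push_cast
    rw [add_mul, one_mul]

/-- If `a` is nilpotent and `[a, b] = b ^ 2` in an algebra over a field of characteristic zero,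
then `b` is nilpotent. -/
theorem isNilpotent_of_commutator_eq_sq_s12 (k : Type*) {R : Type*} [Field k] [CharZero k] [Ring R]
    [Algebra k R] {a b : R} (ha : IsNilpotent a) (h : a * b - b * a = b ^ 2) :
    IsNilpotent b := by
  have had : IsNilpotent (LinearMap.mulLeft k a - LinearMap.mulRight k a) :=
    (LinearMap.commute_mulLeft_right (R := k) a a).isNilpotent_sub
      ((LinearMap.isNilpotent_mulLeft_iff k a).2 ha)
      ((LinearMap.isNilpotent_mulRight_iff k a).2 ha)
  obtain ⟨r, hr⟩ := had
  have key : ∀ s : ℕ, ((LinearMap.mulLeft k a - LinearMap.mulRight k a) ^ s) b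
      = (s.factorial : k) • b ^ (s + 1) := by
    intro s
    induction s with
    | zero => simp
    | succ s ih =>
      rw [pow_succ', Module.End.mul_apply, ih, map_smul, LinearMap.sub_apply,
        LinearMap.mulLeft_apply, LinearMap.mulRight_apply,
        mul_pow_sub_pow_mul_of_commutator_eq_sq h, ← nsmul_eq_mul, ← Nat.cast_smul_eq_nsmul k,
        smul_smul, Nat.factorial_succ, mul_comm (s + 1), Nat.cast_mul]
  refine ⟨r + 1, ?_⟩
  have h0 := key r
  rw [hr, LinearMap.zero_apply] at h0
  exact (smul_eq_zero.1 h0.symm).resolve_left (Nat.cast_ne_zero.2 r.factorial_ne_zero)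

section JordanBlock

variable {k : Type*} [Field k] {n : ℕ} {J : Matrix (Fin n) (Fin n) k}

theorem isNilpotent_of_jordanBlock
    (hJ : ∀ i j : Fin n, J i j = if (i : ℕ) + 1 = (j : ℕ) then 1 else 0) : IsNilpotent J := by
  have key : ∀ (m : ℕ) (i j : Fin n), (i : ℕ) + m ≠ j → (J ^ m) i j = 0 := by
    intro m
    induction m with
    | zero =>
      intro i j hij
      rw [pow_zero, Matrix.one_apply_ne]
      rintro rfl
      simp at hij
    | succ m ih =>
      intro i j hij
      rw [pow_succ, Matrix.mul_apply]
      refine Finset.sum_eq_zero fun l _ => ?_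
      by_cases hl : (i : ℕ) + m = l
      · rw [hJ, if_neg (by omega), mul_zero]
      · rw [ih i l hl, zero_mul]
  refine ⟨n, ?_⟩
  ext i j
  exact key n i j (by omega)

theorem jordanBlock_mulVec_apply
    (hJ : ∀ i j : Fin n, J i j = if (i : ℕ) + 1 = (j : ℕ) then 1 else 0) (w : Fin n → k)
    (i : Fin n) :
    J.mulVec w i = if h : (i : ℕ) + 1 < n then w ⟨i + 1, h⟩ else 0 := by
  simp only [Matrix.mulVec, dotProduct, hJ, ite_mul, one_mul, zero_mul]
  split_ifs with h
  · rw [Finset.sum_eq_single ⟨i + 1, h⟩]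
    · simp
    · intro l _ hl
      exact if_neg fun e => hl (Fin.ext e.symm)
    · simp
  · exact Finset.sum_eq_zero fun l _ => if_neg (by omega)

/-- A subspace invariant under the Jordan block which contains a vector with last nonzero
coordinate `i` contains the first basis vectors up to index `i`. -/
theorem single_mem_of_jordanBlock_invariant
    (hJ : ∀ i j : Fin n, J i j = if (i : ℕ) + 1 = (j : ℕ) then 1 else 0)
    {K : Submodule k (Fin n → k)} (hK : ∀ w ∈ K, J.mulVec w ∈ K) (t : ℕ) :
    ∀ w ∈ K, ∀ i : Fin n, (i : ℕ) = t → w i ≠ 0 → (∀ l, i < l → w l = 0) →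
      ∀ j ≤ i, Pi.single j (1 : k) ∈ K := by
  induction t with
  | zero =>
    intro w hw i hi hwi hl j hj
    obtain rfl : j = i := le_antisymm hj (Fin.le_def.2 (by omega))
    have e : Pi.single j (1 : k) = (w j)⁻¹ • w := by
      ext l
      rcases eq_or_ne l j with rfl | hlj
      · simp [hwi]
      · have : j < l := Fin.lt_def.2 (by have := Fin.val_ne_of_ne hlj; omega)
        simp [hl l this, hlj]
    rw [e]
    exact K.smul_mem _ hw
  | succ t ih =>
    intro w hw i hi hwi hl
    have hlt : ∀ j < i, Pi.single j (1 : k) ∈ K := by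
      intro j hj
      refine ih _ (hK w hw) ⟨t, by omega⟩ rfl ?_ ?_ j (Fin.le_def.2 ?_)
      · rw [jordanBlock_mulVec_apply hJ, dif_pos (by simp only; omega)]
        convert hwi using 2
        exact Fin.ext hi.symm
      · intro l htl
        rw [jordanBlock_mulVec_apply hJ]
        split_ifs with h
        · apply hl
          rw [Fin.lt_def] at htl ⊢
          simp only at htl ⊢
          omega
        · rfl
      · rw [Fin.lt_def] at hj
        simp only
        omega
    intro j hj
    rcases hj.lt_or_eq with hj | rfl
    · exact hlt j hj
    have e : Pi.single j (1 : k)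
        = (w j)⁻¹ • (w - ∑ l ∈ Finset.Iio j, w l • Pi.single l (1 : k)) := by
      ext l
      rcases lt_trichotomy l j with h | rfl | h
      · simp [Finset.sum_apply, Pi.single_apply, h, h.ne]
      · simp [Finset.sum_apply, Pi.single_apply, hwi]
      · simp [Finset.sum_apply, Pi.single_apply, h.ne', hl l h]
    rw [e]
    exact K.smul_mem _ (K.sub_mem hw
      (K.sum_mem fun l hlj => K.smul_mem _ (hlt l (Finset.mem_Iio.1 hlj))))

end JordanBlock

theorem stmt_12 (k : Type*) [Field k] [CharZero k] (n : ℕ) (hn : 1 ≤ n)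
    (J B : Matrix (Fin n) (Fin n) k)
    (hJ : ∀ i j : Fin n, J i j = if (i : ℕ) + 1 = (j : ℕ) then 1 else 0)
    (hB : J * B - B * J = B ^ 2) :
    ∀ i j : Fin n, j ≤ i → B i j = 0 := by
  classical
  intro i j hji
  by_contra hij
  obtain ⟨N, hN⟩ := isNilpotent_of_commutator_eq_sq_s12 k (isNilpotent_of_jordanBlock hJ) hB
  have hex : ∃ m, (B ^ m).mulVec (Pi.single j (1 : k)) = 0 := ⟨N, by rw [hN, Matrix.zero_mulVec]⟩
  obtain ⟨m, hm⟩ : ∃ m, Nat.find hex = m + 1 := by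
    refine Nat.exists_eq_succ_of_ne_zero fun h0 => ?_
    have := Nat.find_spec hex
    rw [h0, pow_zero, Matrix.one_mulVec] at this
    simp at this
  have hspec := Nat.find_spec hex
  rw [hm] at hspec
  have hK : ∀ w ∈ LinearMap.ker (B ^ m).mulVecLin,
      J.mulVec w ∈ LinearMap.ker (B ^ m).mulVecLin := by
    intro w hw
    rw [LinearMap.mem_ker, Matrix.mulVecLin_apply] at hw ⊢
    have h := mul_pow_sub_pow_mul_of_commutator_eq_sq hB m
    have h' : B ^ m * J = J * B ^ m - m * B * B ^ m := by
      rw [mul_assoc, ← pow_succ', ← h, sub_sub_cancel]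
    rw [Matrix.mulVec_mulVec, h', Matrix.sub_mulVec, ← Matrix.mulVec_mulVec,
      ← Matrix.mulVec_mulVec, hw, Matrix.mulVec_zero, Matrix.mulVec_zero, sub_zero]
  have hw : B.mulVec (Pi.single j 1) ∈ LinearMap.ker (B ^ m).mulVecLin := by
    rw [LinearMap.mem_ker, Matrix.mulVecLin_apply, Matrix.mulVec_mulVec, ← pow_succ, hspec]
  have hne : (Finset.univ.filter fun l => B l j ≠ 0).Nonempty := ⟨i, by simpa using hij⟩
  obtain ⟨p, hp, hmax⟩ := Finset.exists_max_image _ id hne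
  simp only [Finset.mem_filter, Finset.mem_univ, true_and, id] at hp hmax
  have hmem := single_mem_of_jordanBlock_invariant hJ hK p _ hw p rfl (by simpa using hp)
    (fun l hl => by
      by_contra h
      exact absurd (hmax l (by simpa using h)) (not_le.2 hl))
    j (hji.trans (hmax i hij))
  exact Nat.find_min hex (hm ▸ Nat.lt_succ_self m) hmem
end
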